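/- arXiv:2004.08561 — 4 statements merged into one kernel-verified Lean document; each statement's English description precedes it below -/
import Mathlib

section
/- Backward-propagation lemma: Let Q ∈ ℝ^{n×n} be symmetric positive definite, let L̄ ∈ ℝ^{n×n} be symmetric positive semidefinite, let A ∈ ℝ^{n×n}, b, s̄ ∈ ℝ^n and r̄ ∈ ℝ. Define Φ = (I + L̄Q)⁻¹ L̄, β = I − QΦ, Ψ = QΦQ − Q, and set L = AᵀΦA, s = Aᵀ(Φb + βᵀ s̄), and r = r̄ − ln det(β) + s̄ᵀΨs̄ + 2 s̄ᵀβ b + bᵀΦ b. Then for every x ∈ ℝ^n, ∫_{ℝ^n} N(ξ | Ax + b, Q) · 𝓛(ξ | r̄, s̄, L̄) dξ = 𝓛(x | r, s, L). (In particular, I + L̄Q and β are invertible and det(β) > 0 under these hypotheses.) -/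
open MeasureTheory Matrix Real

noncomputable def gaussPdf {n : ℕ} (x μ : Fin n → ℝ) (P : Matrix (Fin n) (Fin n) ℝ) : ℝ :=
  ((2 * Real.pi) • P).det ^ (-(1:ℝ)/2) *
    Real.exp (-(1/2) * ((x - μ) ⬝ᵥ (P⁻¹ *ᵥ (x - μ))))

noncomputable def infoLik {n : ℕ} (x : Fin n → ℝ) (r : ℝ) (s : Fin n → ℝ)
    (L : Matrix (Fin n) (Fin n) ℝ) : ℝ :=
  Real.exp (-(1/2) * (r + 2 * (x ⬝ᵥ s) + x ⬝ᵥ (L *ᵥ x)))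

open scoped MatrixOrder in
theorem Matrix.PosDef.exists_isUnit_transpose_mul_self {n : ℕ} {M : Matrix (Fin n) (Fin n) ℝ}
    (hM : M.PosDef) : ∃ B : Matrix (Fin n) (Fin n) ℝ, IsUnit B.det ∧ M = Bᵀ * B := by
  obtain ⟨B, hB⟩ := CStarAlgebra.nonneg_iff_eq_star_mul_self.mp hM.posSemidef.nonneg
  rw [star_eq_conjTranspose, conjTranspose_eq_transpose_of_trivial] at hB
  refine ⟨B, ?_, hB⟩
  have h := hM.det_pos
  rw [hB, det_mul, det_transpose] at h
  exact isUnit_iff_ne_zero.mpr fun h0 => by simp [h0] at h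

/-- The centred Gaussian integral with precision matrix `M`. -/
theorem integral_exp_neg_half_quadratic {n : ℕ} {M : Matrix (Fin n) (Fin n) ℝ} (hM : M.PosDef) :
    ∫ v : Fin n → ℝ, Real.exp (-(1/2) * (v ⬝ᵥ (M *ᵥ v))) = √((2 * π) ^ n / M.det) := by
  obtain ⟨B, hB, rfl⟩ := hM.exists_isUnit_transpose_mul_self
  have hB0 : B.det ≠ 0 := hB.ne_zero
  have hstd : ∫ v : Fin n → ℝ, Real.exp (-(1/2) * (v ⬝ᵥ v)) = √((2 * π) ^ n) := by
    have h1 : ∀ v : Fin n → ℝ, Real.exp (-(1/2) * (v ⬝ᵥ v))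
        = ∏ i, Real.exp (-(1/2) * (v i) ^ 2) := fun v => by
      rw [← Real.exp_sum, dotProduct, Finset.mul_sum]
      simp [sq]
    simp_rw [h1]
    rw [integral_fintype_prod_volume_eq_pow (fun t : ℝ => Real.exp (-(1/2) * t ^ 2)),
      integral_gaussian, Fintype.card_fin, Real.sqrt_eq_rpow, Real.sqrt_eq_rpow,
      ← Real.rpow_mul_natCast (by positivity), mul_comm ((1:ℝ)/2) (n:ℝ),
      Real.rpow_mul (by positivity), Real.rpow_natCast]
    congr 2
    ring
  have hquad : ∀ v : Fin n → ℝ, v ⬝ᵥ ((Bᵀ * B) *ᵥ v) = (B *ᵥ v) ⬝ᵥ (B *ᵥ v) := fun v => by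
    rw [← mulVec_mulVec, dotProduct_mulVec, vecMul_transpose]
  have hmap := integral_map (μ := (volume : Measure (Fin n → ℝ)))
    (φ := fun v => B *ᵥ v) (f := fun v : Fin n → ℝ => Real.exp (-(1/2) * (v ⬝ᵥ v)))
    (by fun_prop) (by
      apply Continuous.aestronglyMeasurable
      unfold dotProduct
      fun_prop)
  have hvol := Real.map_matrix_volume_pi_eq_smul_volume_pi hB0
  have hfun : (fun v => B *ᵥ v) = ⇑(toLin' B) := by ext; simp
  rw [hfun, hvol, integral_smul_measure, hstd] at hmap
  simp_rw [hquad]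
  rw [← hmap, det_mul, det_transpose, Real.sqrt_div' _ (mul_self_nonneg _),
    Real.sqrt_mul_self_eq_abs, ENNReal.toReal_ofReal (abs_nonneg _), abs_inv, smul_eq_mul]
  field_simp

/-- Completing the square: `c` is the stationary point of the combined quadratic form. -/
theorem quadratic_add_of_stationary {n : ℕ} {P L : Matrix (Fin n) (Fin n) ℝ}
    (hP : Pᵀ = P) (hL : Lᵀ = L) {m s c : Fin n → ℝ} (hc : P *ᵥ (c - m) + s + L *ᵥ c = 0)
    (v : Fin n → ℝ) :
    (v + c - m) ⬝ᵥ (P *ᵥ (v + c - m)) + 2 * ((v + c) ⬝ᵥ s) + (v + c) ⬝ᵥ (L *ᵥ (v + c))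
      = v ⬝ᵥ ((P + L) *ᵥ v) + (m ⬝ᵥ (s + L *ᵥ c) + c ⬝ᵥ s) := by
  have hsymm : ∀ {N : Matrix (Fin n) (Fin n) ℝ}, Nᵀ = N → ∀ x y : Fin n → ℝ,
      x ⬝ᵥ (N *ᵥ y) = y ⬝ᵥ (N *ᵥ x) := fun {N} hN x y => by
    rw [dotProduct_mulVec, ← mulVec_transpose, hN, dotProduct_comm]
  have hv := congrArg (v ⬝ᵥ ·) hc
  have hcc := congrArg (c ⬝ᵥ ·) hc
  have hm := congrArg (m ⬝ᵥ ·) hc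
  have e1 := hsymm hP c v
  have e2 := hsymm hP m v
  have e4 := hsymm hL c v
  simp only [mulVec_add, mulVec_sub, add_mulVec, dotProduct_add, dotProduct_sub, add_dotProduct,
    sub_dotProduct, dotProduct_zero] at hv hcc hm e1 e2 e4 ⊢
  linear_combination 2 * hv + hcc - hm + e1 - e2 + e4

/-- Backward-propagation lemma (Lemma B.1 of the paper). -/
theorem backward_propagation {n : ℕ}
    (Q Lbar A : Matrix (Fin n) (Fin n) ℝ)
    (b sbar : Fin n → ℝ) (rbar : ℝ)
    (hQ : Q.PosDef) (hLbar : Lbar.PosSemidef)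
    (Phi beta Psi L : Matrix (Fin n) (Fin n) ℝ)
    (s : Fin n → ℝ) (r : ℝ)
    (hPhi : Phi = (1 + Lbar * Q)⁻¹ * Lbar)
    (hbeta : beta = 1 - Q * Phi)
    (hPsi : Psi = Q * Phi * Q - Q)
    (hL : L = Aᵀ * Phi * A)
    (hs : s = Aᵀ *ᵥ (Phi *ᵥ b + betaᵀ *ᵥ sbar))
    (hr : r = rbar - Real.log beta.det + sbar ⬝ᵥ (Psi *ᵥ sbar)
        + 2 * (sbar ⬝ᵥ (beta *ᵥ b)) + b ⬝ᵥ (Phi *ᵥ b)) :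
    IsUnit (1 + Lbar * Q) ∧ IsUnit beta ∧ 0 < beta.det ∧
      ∀ x : Fin n → ℝ,
        (∫ ξ : Fin n → ℝ, gaussPdf ξ (A *ᵥ x + b) Q * infoLik ξ rbar sbar Lbar)
          = infoLik x r s L := by
  have hQu : IsUnit Q.det := (isUnit_iff_isUnit_det _).1 hQ.isUnit
  have hM : (Q⁻¹ + Lbar).PosDef := hQ.inv.add_posSemidef hLbar
  have hQT : Qᵀ = Q := by simpa using hQ.isHermitian.eq
  have hLT : Lbarᵀ = Lbar := by simpa using hLbar.isHermitian.eq
  have hQiT : (Q⁻¹)ᵀ = Q⁻¹ := by rw [transpose_nonsing_inv, hQT]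
  have hMQ : (Q⁻¹ + Lbar) * Q = 1 + Lbar * Q := by rw [add_mul, nonsing_inv_mul _ hQu]
  have hQM : Q * (Q⁻¹ + Lbar) = 1 + Q * Lbar := by rw [mul_add, mul_nonsing_inv _ hQu]
  have hU : IsUnit (1 + Lbar * Q) := hMQ ▸ hM.isUnit.mul hQ.isUnit
  have hUd : IsUnit (1 + Lbar * Q).det := (isUnit_iff_isUnit_det _).1 hU
  have hPhi1 : (1 + Lbar * Q) * Phi = Lbar := by
    rw [hPhi, mul_nonsing_inv_cancel_left _ _ hUd]
  have hPhi2 : Phi * (1 + Q * Lbar) = Lbar := by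
    have : Lbar * (1 + Q * Lbar) = (1 + Lbar * Q) * Lbar := by noncomm_ring
    rw [hPhi, mul_assoc, this, nonsing_inv_mul_cancel_left _ _ hUd]
  have hbeta1 : beta * (1 + Q * Lbar) = 1 := by
    rw [hbeta, sub_mul, mul_assoc Q, hPhi2]; noncomm_ring
  have hbeta2 : (1 + Q * Lbar) * beta = 1 := mul_eq_one_comm.1 hbeta1
  have hLbeta : Lbar * beta = Phi := by
    conv_lhs => rw [← hPhi2]
    rw [mul_assoc, hbeta2, mul_one]
  have hPhiT : Phiᵀ = Phi := by
    have h := congrArg transpose hPhi1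
    rw [transpose_mul, transpose_add, transpose_mul, hQT, hLT, transpose_one] at h
    calc Phiᵀ = Phiᵀ * (1 + Q * Lbar) * beta := by rw [mul_assoc, hbeta2, mul_one]
      _ = Phi := by rw [h, hLbeta]
  have hbetaT : betaᵀ = 1 - Phi * Q := by
    rw [hbeta, transpose_sub, transpose_mul, hPhiT, hQT, transpose_one]
  have hdet : beta.det * (Q.det * (Q⁻¹ + Lbar).det) = 1 := by
    rw [← det_mul, ← det_mul, hQM, hbeta1, det_one]
  have hbpos : 0 < beta.det :=
    pos_of_mul_pos_left (hdet ▸ one_pos) (mul_pos hQ.det_pos hM.det_pos).le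
  refine ⟨hU, IsUnit.of_mul_eq_one _ hbeta1, hbpos, fun x => ?_⟩
  set m := A *ᵥ x + b with hm
  set c := beta *ᵥ (m - Q *ᵥ sbar) with hc
  have hstat : Q⁻¹ *ᵥ (c - m) + sbar + Lbar *ᵥ c = 0 := by
    have h : (Q⁻¹ + Lbar) * beta = Q⁻¹ := by
      calc (Q⁻¹ + Lbar) * beta = Q⁻¹ * (Q * (Q⁻¹ + Lbar)) * beta := by
            rw [nonsing_inv_mul_cancel_left _ _ hQu]
        _ = Q⁻¹ := by rw [hQM, mul_assoc, hbeta2, mul_one]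
    have h2 : Q⁻¹ *ᵥ c + Lbar *ᵥ c = Q⁻¹ *ᵥ m - sbar := by
      rw [← add_mulVec, hc, mulVec_mulVec, h, mulVec_sub, mulVec_mulVec,
        nonsing_inv_mul _ hQu, one_mulVec]
    rw [mulVec_sub]
    linear_combination h2
  have hconst : m ⬝ᵥ (sbar + Lbar *ᵥ c) + c ⬝ᵥ sbar
      = m ⬝ᵥ (Phi *ᵥ m) + 2 * (sbar ⬝ᵥ (beta *ᵥ m)) + sbar ⬝ᵥ (Psi *ᵥ sbar) := by
    have e1 : Lbar *ᵥ c = Phi *ᵥ m - Phi *ᵥ (Q *ᵥ sbar) := by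
      rw [hc, mulVec_mulVec, hLbeta, mulVec_sub]
    have e2 : sbar ⬝ᵥ (beta *ᵥ m) = m ⬝ᵥ sbar - m ⬝ᵥ (Phi *ᵥ (Q *ᵥ sbar)) := by
      rw [dotProduct_mulVec, ← mulVec_transpose, hbetaT, dotProduct_comm, sub_mulVec,
        one_mulVec, dotProduct_sub, mulVec_mulVec]
    have e3 : c ⬝ᵥ sbar = sbar ⬝ᵥ (beta *ᵥ m) + sbar ⬝ᵥ (Psi *ᵥ sbar) := by
      have : Psi = -(beta * Q) := by rw [hPsi, hbeta]; noncomm_ring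
      rw [dotProduct_comm, hc, mulVec_sub, dotProduct_sub, this, neg_mulVec, dotProduct_neg,
        mulVec_mulVec, sub_eq_add_neg]
    rw [e1, e3, dotProduct_add, dotProduct_sub]
    linear_combination -e2
  have hexp : rbar + (m ⬝ᵥ (Phi *ᵥ m) + 2 * (sbar ⬝ᵥ (beta *ᵥ m)) + sbar ⬝ᵥ (Psi *ᵥ sbar))
      = Real.log beta.det + (r + 2 * (x ⬝ᵥ s) + x ⬝ᵥ (L *ᵥ x)) := by
    have hA : ∀ y, x ⬝ᵥ (Aᵀ *ᵥ y) = (A *ᵥ x) ⬝ᵥ y := fun y => by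
      rw [dotProduct_mulVec, vecMul_transpose]
    have e1 : b ⬝ᵥ (Phi *ᵥ (A *ᵥ x)) = (A *ᵥ x) ⬝ᵥ (Phi *ᵥ b) := by
      rw [dotProduct_mulVec, ← mulVec_transpose, hPhiT, dotProduct_comm]
    have e2 : sbar ⬝ᵥ (beta *ᵥ (A *ᵥ x)) = (A *ᵥ x) ⬝ᵥ (betaᵀ *ᵥ sbar) := by
      rw [dotProduct_mulVec, ← mulVec_transpose, dotProduct_comm]
    rw [hr, hs, hL, ← mulVec_mulVec, ← mulVec_mulVec, hA, hA, hm]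
    simp only [mulVec_add, dotProduct_add, add_dotProduct]
    linear_combination e1 + 2 * e2
  have hintegrand : ∀ v : Fin n → ℝ,
      gaussPdf (v + c) m Q * infoLik (v + c) rbar sbar Lbar
        = ((2 * π) • Q).det ^ (-(1:ℝ)/2) *
          Real.exp (-(1/2) * (Real.log beta.det + (r + 2 * (x ⬝ᵥ s) + x ⬝ᵥ (L *ᵥ x)))) *
          Real.exp (-(1/2) * (v ⬝ᵥ ((Q⁻¹ + Lbar) *ᵥ v))) := fun v => by
    rw [gaussPdf, infoLik, mul_assoc, mul_assoc, ← Real.exp_add, ← Real.exp_add]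
    congr 2
    linear_combination -(1/2) * (quadratic_add_of_stationary hQiT hLT hstat v + hconst + hexp)
  rw [← integral_add_right_eq_self _ c]
  simp_rw [hintegrand]
  rw [integral_const_mul, integral_exp_neg_half_quadratic hM, infoLik, mul_add (-(1/2) : ℝ),
    Real.exp_add]
  have hbexp : Real.exp (-(1/2) * Real.log beta.det) = (√beta.det)⁻¹ := by
    rw [Real.sqrt_eq_rpow, ← Real.rpow_neg hbpos.le, Real.rpow_def_of_pos hbpos]
    ring_nf
  have hQdet : ((2 * π) • Q).det ^ (-(1:ℝ)/2) = (√((2 * π) ^ n * Q.det))⁻¹ := by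
    have := hQ.det_pos
    rw [det_smul, Fintype.card_fin, Real.sqrt_eq_rpow, ← Real.rpow_neg (by positivity)]
    ring_nf
  have hnorm : (√((2 * π) ^ n * Q.det))⁻¹ * (√beta.det)⁻¹ *
      √((2 * π) ^ n / (Q⁻¹ + Lbar).det) = 1 := by
    have h1 := hQ.det_pos
    have h2 := hM.det_pos
    rw [← Real.sqrt_inv, ← Real.sqrt_inv, ← Real.sqrt_mul (by positivity),
      ← Real.sqrt_mul (by positivity), Real.sqrt_eq_one]
    field_simp
    linear_combination -hdet
  rw [hbexp, hQdet]
  linear_combination Real.exp (-(1/2) * (r + 2 * (x ⬝ᵥ s) + x ⬝ᵥ (L *ᵥ x))) * hnorm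
end

section
/- Smoothed-mode lemma: Let P ∈ ℝ^{n×n} be symmetric positive definite, let L ∈ ℝ^{n×n} be symmetric positive semidefinite, let μ, s ∈ ℝ^n, r ∈ ℝ and w > 0. Define P̄ = (P⁻¹ + L)⁻¹, μ̄ = P̄(P⁻¹μ − s), β = μ̄ᵀP̄⁻¹μ̄ − μᵀP⁻¹μ − r, and w̄ = w · det(2πP̄)^{1/2} · det(2πP)^{-1/2} · exp(β/2). Then for every x ∈ ℝ^n, w · N(x | μ, P) · 𝓛(x | r, s, L) = w̄ · N(x | μ̄, P̄). (In particular, P⁻¹ + L is symmetric positive definite.) -/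
open MeasureTheory Matrix Real

/-- Expansion of the quadratic form of a symmetric matrix at a difference of vectors. -/
theorem dotProduct_mulVec_sub_sub {ι : Type*} [Fintype ι] {A : Matrix ι ι ℝ}
    (hA : A.IsHermitian) (x y : ι → ℝ) :
    (x - y) ⬝ᵥ (A *ᵥ (x - y)) = x ⬝ᵥ (A *ᵥ x) - 2 * (x ⬝ᵥ (A *ᵥ y)) + y ⬝ᵥ (A *ᵥ y) := by
  have hT : Aᵀ = A := by simpa using hA.eq
  have hswap : y ⬝ᵥ (A *ᵥ x) = x ⬝ᵥ (A *ᵥ y) := by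
    rw [dotProduct_mulVec, ← mulVec_transpose, hT, dotProduct_comm]
  rw [mulVec_sub, dotProduct_sub, sub_dotProduct, sub_dotProduct, hswap]
  ring

/-- Smoothed-mode lemma (Lemma B.3 of the paper). -/
theorem smoothed_mode {n : ℕ}
    (P : Matrix (Fin n) (Fin n) ℝ) (hP : P.PosDef)
    (L : Matrix (Fin n) (Fin n) ℝ) (hL : L.PosSemidef)
    (μ s : Fin n → ℝ) (r w : ℝ) (hw : 0 < w)
    (Pbar : Matrix (Fin n) (Fin n) ℝ) (μbar : Fin n → ℝ) (β wbar : ℝ)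
    (hPbar : Pbar = (P⁻¹ + L)⁻¹)
    (hμbar : μbar = Pbar *ᵥ (P⁻¹ *ᵥ μ - s))
    (hβ : β = μbar ⬝ᵥ (Pbar⁻¹ *ᵥ μbar) - μ ⬝ᵥ (P⁻¹ *ᵥ μ) - r)
    (hwbar : wbar = w * ((2 * Real.pi) • Pbar).det ^ ((1:ℝ)/2)
        * ((2 * Real.pi) • P).det ^ (-(1:ℝ)/2) * Real.exp (β / 2)) :
    (P⁻¹ + L).PosDef ∧
      ∀ x : Fin n → ℝ,
        w * gaussPdf x μ P * infoLik x r s L = wbar * gaussPdf x μbar Pbar := by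
  have hQ : (P⁻¹ + L).PosDef := hP.inv.add_posSemidef hL
  refine ⟨hQ, fun x => ?_⟩
  have hinv : Pbar⁻¹ = P⁻¹ + L := by
    rw [hPbar, Matrix.nonsing_inv_nonsing_inv _ ((Matrix.isUnit_iff_isUnit_det _).1 hQ.isUnit)]
  have hmean : (P⁻¹ + L) *ᵥ μbar = P⁻¹ *ᵥ μ - s := by
    rw [hμbar, hPbar, mulVec_mulVec, Matrix.mul_nonsing_inv _
      ((Matrix.isUnit_iff_isUnit_det _).1 hQ.isUnit), one_mulVec]
  have hPbar_pos : Pbar.PosDef := hPbar ▸ hQ.inv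
  have hdet : 0 < ((2 * Real.pi) • Pbar).det := (hPbar_pos.smul (by positivity)).det_pos
  have hcancel : ((2 * Real.pi) • Pbar).det ^ ((1:ℝ)/2)
      * ((2 * Real.pi) • Pbar).det ^ (-(1:ℝ)/2) = 1 := by
    rw [← Real.rpow_add hdet]
    norm_num
  have hexponent : -(1/2) * ((x - μ) ⬝ᵥ (P⁻¹ *ᵥ (x - μ)))
      + -(1/2) * (r + 2 * (x ⬝ᵥ s) + x ⬝ᵥ (L *ᵥ x))
      = β / 2 + -(1/2) * ((x - μbar) ⬝ᵥ (Pbar⁻¹ *ᵥ (x - μbar))) := by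
    have hquad := dotProduct_mulVec_sub_sub hP.inv.isHermitian x μ
    have hquad' := dotProduct_mulVec_sub_sub hQ.isHermitian x μbar
    rw [hβ, hinv, hquad, hquad', hmean, add_mulVec, dotProduct_add, dotProduct_sub x]
    ring
  unfold gaussPdf infoLik
  rw [hwbar]
  calc _ = w * ((2 * Real.pi) • P).det ^ (-(1:ℝ)/2)
        * (Real.exp (-(1/2) * ((x - μ) ⬝ᵥ (P⁻¹ *ᵥ (x - μ))))
          * Real.exp (-(1/2) * (r + 2 * (x ⬝ᵥ s) + x ⬝ᵥ (L *ᵥ x)))) := by ring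
    _ = w * ((2 * Real.pi) • P).det ^ (-(1:ℝ)/2)
        * (((2 * Real.pi) • Pbar).det ^ ((1:ℝ)/2) * ((2 * Real.pi) • Pbar).det ^ (-(1:ℝ)/2))
        * (Real.exp (β / 2)
          * Real.exp (-(1/2) * ((x - μbar) ⬝ᵥ (Pbar⁻¹ *ᵥ (x - μbar))))) := by
      rw [hcancel, ← Real.exp_add, hexponent, Real.exp_add, mul_one]
    _ = _ := by ring
end

section
/- Kalman measurement-update density factorization (correction step of the forward filter): Let P ∈ ℝ^{n×n} and R ∈ ℝ^{p×p} be symmetric positive definite, C ∈ ℝ^{p×n}, D ∈ ℝ^{p×q}, μ ∈ ℝ^n, u ∈ ℝ^q, y ∈ ℝ^p. Define η = Cμ + Du, Σ = CPCᵀ + R, K = PCᵀΣ⁻¹, μ⁺ = μ + K(y − η), and P⁺ = P − KCP. Then Σ and P⁺ are symmetric positive definite, and for every x ∈ ℝ^n, N(y | Cx + Du, R) · N(x | μ, P) = N(y | η, Σ) · N(x | μ⁺, P⁺). -/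
open MeasureTheory Matrix Real

theorem Matrix.PosDef.mul_mul_transpose_add {m n : Type*} [Fintype m] [Fintype n]
    {P : Matrix n n ℝ} (hP : P.PosDef) {R : Matrix m m ℝ} (hR : R.PosDef) (C : Matrix m n ℝ) :
    (C * P * Cᵀ + R).PosDef := by
  have h := hP.posSemidef.mul_mul_conjTranspose_same C
  rw [conjTranspose_eq_transpose_of_trivial] at h
  exact PosDef.posSemidef_add h hR

theorem Matrix.PosDef.inv_add_transpose_mul_inv_mul {m n : Type*} [Fintype m] [Fintype n]
    [DecidableEq m] [DecidableEq n]
    {P : Matrix n n ℝ} (hP : P.PosDef) {R : Matrix m m ℝ} (hR : R.PosDef) (C : Matrix m n ℝ) :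
    (P⁻¹ + Cᵀ * R⁻¹ * C).PosDef := by
  have h := hR.inv.posSemidef.conjTranspose_mul_mul_same C
  rw [conjTranspose_eq_transpose_of_trivial] at h
  exact PosDef.add_posSemidef hP.inv h

/-- The posterior precision times the Kalman gain. -/
theorem precision_mul_gain {m n : Type*} [Fintype m] [Fintype n] [DecidableEq m] [DecidableEq n]
    {P : Matrix n n ℝ} (hP : P.PosDef) {R : Matrix m m ℝ} (hR : R.PosDef) (C : Matrix m n ℝ) :
    (P⁻¹ + Cᵀ * R⁻¹ * C) * (P * Cᵀ * (C * P * Cᵀ + R)⁻¹) = Cᵀ * R⁻¹ := by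
  have hS := (hP.mul_mul_transpose_add hR C).isUnit.map detMonoidHom
  have hPu := hP.isUnit.map detMonoidHom
  have hRu := hR.isUnit.map detMonoidHom
  have key : (P⁻¹ + Cᵀ * R⁻¹ * C) * (P * Cᵀ) = Cᵀ * R⁻¹ * (C * P * Cᵀ + R) := by
    rw [Matrix.add_mul, Matrix.mul_add, ← Matrix.mul_assoc P⁻¹, nonsing_inv_mul _ hPu, Matrix.one_mul,
      Matrix.mul_assoc Cᵀ R⁻¹ R, nonsing_inv_mul _ hRu, Matrix.mul_one, add_comm]
    simp only [Matrix.mul_assoc]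
  rw [← Matrix.mul_assoc, key, Matrix.mul_assoc, mul_nonsing_inv _ hS, Matrix.mul_one]

/-- The Woodbury identity in the form used by the Kalman filter. -/
theorem posterior_covariance_eq_inv {m n : Type*} [Fintype m] [Fintype n] [DecidableEq m]
    [DecidableEq n]
    {P : Matrix n n ℝ} (hP : P.PosDef) {R : Matrix m m ℝ} (hR : R.PosDef) (C : Matrix m n ℝ) :
    P - P * Cᵀ * (C * P * Cᵀ + R)⁻¹ * C * P = (P⁻¹ + Cᵀ * R⁻¹ * C)⁻¹ := by
  have hPu := hP.isUnit.map detMonoidHom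
  refine (inv_eq_right_inv ?_).symm
  rw [Matrix.mul_sub, Matrix.mul_assoc (P * Cᵀ * _) C P, ← Matrix.mul_assoc _ (P * Cᵀ * _),
    precision_mul_gain hP hR, Matrix.add_mul, nonsing_inv_mul _ hPu]
  simp only [Matrix.mul_assoc, add_sub_cancel_right]

theorem det_posterior_covariance {m n : Type*} [Fintype m] [Fintype n] [DecidableEq m]
    [DecidableEq n]
    {P : Matrix n n ℝ} (hP : P.PosDef) {R : Matrix m m ℝ} (hR : R.PosDef) (C : Matrix m n ℝ) :
    R.det * P.det = (C * P * Cᵀ + R).det * (P⁻¹ + Cᵀ * R⁻¹ * C)⁻¹.det := by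
  have hPu := hP.isUnit.map detMonoidHom
  have hRu := hR.isUnit.map detMonoidHom
  have hL := (hP.inv_add_transpose_mul_inv_mul hR C).det_pos.ne'
  have h₁ : (P⁻¹ + Cᵀ * R⁻¹ * C).det * P.det = (1 + Cᵀ * (R⁻¹ * C * P)).det := by
    rw [← det_mul, Matrix.add_mul, nonsing_inv_mul _ hPu]
    simp only [Matrix.mul_assoc]
  have h₂ : (C * P * Cᵀ + R).det = R.det * (1 + Cᵀ * (R⁻¹ * C * P)).det := by
    rw [det_one_add_mul_comm, ← det_mul, Matrix.mul_add, Matrix.mul_one, add_comm]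
    simp only [← Matrix.mul_assoc]
    rw [mul_nonsing_inv _ hRu, Matrix.one_mul]
  rw [h₂, ← h₁, det_nonsing_inv, Ring.inverse_eq_inv']
  field_simp

/-- Completing the square in the Kalman measurement update. -/
theorem kalman_quadratic_identity {m n : Type*} [Fintype m] [Fintype n] [DecidableEq m]
    [DecidableEq n]
    {P : Matrix n n ℝ} (hP : P.PosDef) {R : Matrix m m ℝ} (hR : R.PosDef) (C : Matrix m n ℝ)
    {K : Matrix n m ℝ} (hK : K = P * Cᵀ * (C * P * Cᵀ + R)⁻¹) (e : m → ℝ) (d : n → ℝ) :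
    (e - C *ᵥ d) ⬝ᵥ (R⁻¹ *ᵥ (e - C *ᵥ d)) + d ⬝ᵥ (P⁻¹ *ᵥ d) =
      e ⬝ᵥ ((C * P * Cᵀ + R)⁻¹ *ᵥ e) +
        (d - K *ᵥ e) ⬝ᵥ ((P⁻¹ + Cᵀ * R⁻¹ * C) *ᵥ (d - K *ᵥ e)) := by
  have hS := hP.mul_mul_transpose_add hR C
  have hSu := hS.isUnit.map detMonoidHom
  have hRu := hR.isUnit.map detMonoidHom
  have hLT : (P⁻¹ + Cᵀ * R⁻¹ * C)ᵀ = P⁻¹ + Cᵀ * R⁻¹ * C :=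
    (hP.inv_add_transpose_mul_inv_mul hR C).isHermitian
  have hRT : R⁻¹ᵀ = R⁻¹ := hR.inv.isHermitian
  have hST : (C * P * Cᵀ + R)⁻¹ᵀ = (C * P * Cᵀ + R)⁻¹ := hS.inv.isHermitian
  have hPT : Pᵀ = P := hP.isHermitian
  have hLK : (P⁻¹ + Cᵀ * R⁻¹ * C) * K = Cᵀ * R⁻¹ := hK ▸ precision_mul_gain hP hR C
  have hKL : Kᵀ * (P⁻¹ + Cᵀ * R⁻¹ * C) = R⁻¹ * C := by
    have h := congrArg transpose hLK
    rwa [transpose_mul, hLT, transpose_mul, hRT, transpose_transpose] at h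
  have hKC : Kᵀ * (Cᵀ * R⁻¹) = R⁻¹ - (C * P * Cᵀ + R)⁻¹ := by
    have hKT : Kᵀ = (C * P * Cᵀ + R)⁻¹ * (C * P) := by
      rw [hK, transpose_mul, transpose_mul, hST, hPT, transpose_transpose]
    rw [eq_sub_iff_add_eq, hKT]
    calc (C * P * Cᵀ + R)⁻¹ * (C * P) * (Cᵀ * R⁻¹) + (C * P * Cᵀ + R)⁻¹
        = (C * P * Cᵀ + R)⁻¹ * (C * P * Cᵀ + R) * R⁻¹ := by
          rw [Matrix.mul_assoc _ (C * P * Cᵀ + R) R⁻¹, Matrix.add_mul, mul_nonsing_inv _ hRu, Matrix.mul_add,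
            Matrix.mul_one]
          simp only [Matrix.mul_assoc]
      _ = R⁻¹ := by rw [nonsing_inv_mul _ hSu, Matrix.one_mul]
  have hmove : ∀ (v : n → ℝ), (K *ᵥ e) ⬝ᵥ v = e ⬝ᵥ (Kᵀ *ᵥ v) := fun v => by
    rw [dotProduct_mulVec, vecMul_transpose]
  have hmoveC : ∀ (v : m → ℝ), (C *ᵥ d) ⬝ᵥ v = d ⬝ᵥ (Cᵀ *ᵥ v) := fun v => by
    rw [dotProduct_mulVec, vecMul_transpose]
  simp only [mulVec_sub, sub_dotProduct, dotProduct_sub, hmove, hmoveC, mulVec_mulVec, hLK, hKL,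
    hKC, sub_mulVec]
  simp only [add_mulVec, dotProduct_add, Matrix.mul_assoc]
  ring

theorem gaussPdf_mul_gaussPdf {m n : ℕ} (x μ : Fin m → ℝ) (P : Matrix (Fin m) (Fin m) ℝ)
    (hP : P.PosDef) (y η : Fin n → ℝ) (R : Matrix (Fin n) (Fin n) ℝ) (hR : R.PosDef) :
    gaussPdf x μ P * gaussPdf y η R =
      ((2 * π) ^ m * (2 * π) ^ n * (P.det * R.det)) ^ (-(1 : ℝ) / 2) *
        exp (-(1 / 2) *
          ((x - μ) ⬝ᵥ (P⁻¹ *ᵥ (x - μ)) + (y - η) ⬝ᵥ (R⁻¹ *ᵥ (y - η)))) := by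
  have hp := hP.det_pos
  have hr := hR.det_pos
  have h : (2 * π) ^ m * (2 * π) ^ n * (P.det * R.det) =
      (2 * π) ^ m * P.det * ((2 * π) ^ n * R.det) := by ring
  rw [gaussPdf, gaussPdf, det_smul, det_smul, Fintype.card_fin, Fintype.card_fin, h,
    mul_rpow (x := (2 * π) ^ m * P.det) (y := (2 * π) ^ n * R.det) (by positivity) (by positivity),
    mul_add, exp_add]
  ring

/-- Kalman measurement-update density factorization (correction step of the forward filter). -/
theorem kalman_correction {n p q : ℕ}
    (P : Matrix (Fin n) (Fin n) ℝ) (hP : P.PosDef)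
    (R : Matrix (Fin p) (Fin p) ℝ) (hR : R.PosDef)
    (C : Matrix (Fin p) (Fin n) ℝ) (D : Matrix (Fin p) (Fin q) ℝ)
    (μ : Fin n → ℝ) (u : Fin q → ℝ) (y : Fin p → ℝ)
    (η : Fin p → ℝ) (Sig : Matrix (Fin p) (Fin p) ℝ)
    (K : Matrix (Fin n) (Fin p) ℝ)
    (μplus : Fin n → ℝ) (Pplus : Matrix (Fin n) (Fin n) ℝ)
    (hη : η = C *ᵥ μ + D *ᵥ u)
    (hSig : Sig = C * P * Cᵀ + R)
    (hK : K = P * Cᵀ * Sig⁻¹)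
    (hμplus : μplus = μ + K *ᵥ (y - η))
    (hPplus : Pplus = P - K * C * P) :
    Sig.PosDef ∧ Pplus.PosDef ∧
      ∀ x : Fin n → ℝ,
        gaussPdf y (C *ᵥ x + D *ᵥ u) R * gaussPdf x μ P
          = gaussPdf y η Sig * gaussPdf x μplus Pplus := by
  subst hη hSig hμplus hPplus
  have hS := hP.mul_mul_transpose_add hR C
  have hL := hP.inv_add_transpose_mul_inv_mul hR C
  have hinv : P - K * C * P = (P⁻¹ + Cᵀ * R⁻¹ * C)⁻¹ := hK ▸ posterior_covariance_eq_inv hP hR C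
  rw [hinv]
  refine ⟨hS, hL.inv, fun x => ?_⟩
  rw [gaussPdf_mul_gaussPdf _ _ _ hR _ _ _ hP, gaussPdf_mul_gaussPdf _ _ _ hS _ _ _ hL.inv,
    det_posterior_covariance hP hR C, nonsing_inv_nonsing_inv _ (hL.isUnit.map detMonoidHom)]
  have h := kalman_quadratic_identity hP hR C hK (y - (C *ᵥ μ + D *ᵥ u)) (x - μ)
  have hy : y - (C *ᵥ μ + D *ᵥ u) - C *ᵥ (x - μ) = y - (C *ᵥ x + D *ᵥ u) := by
    rw [mulVec_sub]; abel
  rw [hy, sub_sub x μ] at h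
  rw [h]
end

section
/- Counter-example to non-negativity of differential entropy change under Kullback–Leibler merging: Define the probability densities on ℝ given by p(x) = 0.25·N(x | −0.9, 1) + 0.25·N(x | 0.9, 1) + 0.5·N(x | 0, 0.1) and q(x) = 0.5·N(x | 0, 1.81) + 0.5·N(x | 0, 0.1), where q is obtained from p by replacing the first two components by their moment-matched merge. Then the differential entropy change Δh(p,q) = ∫_{−∞}^{∞} ( p(x) ln p(x) − q(x) ln q(x) ) dx is strictly negative. -/
open MeasureTheory Real

/-- Scalar Gaussian density. -/
noncomputable def gauss1 (x μ P : ℝ) : ℝ :=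
  (2 * Real.pi * P) ^ (-(1:ℝ)/2) * Real.exp (-(x - μ) ^ 2 / (2 * P))

open ProbabilityTheory

lemma gauss1_eq_inv_sqrt_mul_exp (x μ : ℝ) {P : ℝ} (hP : 0 < P) :
    gauss1 x μ P = (√(2 * π * P))⁻¹ * exp (-(x - μ) ^ 2 / (2 * P)) := by
  rw [gauss1, neg_div, rpow_neg (by positivity), sqrt_eq_rpow]

lemma gauss1_pos (x μ : ℝ) {P : ℝ} (hP : 0 < P) : 0 < gauss1 x μ P := by
  rw [gauss1_eq_inv_sqrt_mul_exp x μ hP]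
  positivity

lemma gauss1_eq_gaussianPDFReal (μ : ℝ) {P : ℝ} (hP : 0 < P) :
    (fun x => gauss1 x μ P) = gaussianPDFReal μ P.toNNReal := by
  funext x
  simp only [gauss1_eq_inv_sqrt_mul_exp x μ hP, gaussianPDFReal, coe_toNNReal P hP.le]

lemma integrable_gauss1 (μ : ℝ) {P : ℝ} (hP : 0 < P) : Integrable fun x => gauss1 x μ P := by
  rw [gauss1_eq_gaussianPDFReal μ hP]
  exact integrable_gaussianPDFReal _ _

lemma integral_gauss1 (μ : ℝ) {P : ℝ} (hP : 0 < P) : ∫ x, gauss1 x μ P = 1 := by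
  rw [gauss1_eq_gaussianPDFReal μ hP]
  exact integral_gaussianPDFReal_eq_one _ (toNNReal_pos.2 hP).ne'

lemma integral_sq_mul_gauss1 (μ : ℝ) {P : ℝ} (hP : 0 < P) :
    ∫ x, x ^ 2 * gauss1 x μ P = μ ^ 2 + P := by
  have hv : P.toNNReal ≠ 0 := (toNNReal_pos.2 hP).ne'
  have hvar := variance_eq_sub (memLp_id_gaussianReal (μ := μ) (v := P.toNNReal) 2)
  rw [variance_id_gaussianReal] at hvar
  simp only [Pi.pow_apply, id_eq, integral_id_gaussianReal] at hvar
  rw [integral_gaussianReal_eq_integral_smul hv] at hvar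
  have hpdf := congrFun (gauss1_eq_gaussianPDFReal μ hP)
  simp only [← hpdf, smul_eq_mul, mul_comm (gauss1 _ _ _), coe_toNNReal P hP.le] at hvar
  linarith

lemma integrable_sq_mul_gauss1 (μ : ℝ) {P : ℝ} (hP : 0 < P) :
    Integrable fun x => x ^ 2 * gauss1 x μ P := by
  by_contra h
  have h0 := integral_sq_mul_gauss1 μ hP
  rw [integral_undef h] at h0
  linarith [sq_nonneg μ]

/-- A product of two Gaussian densities divided by a centred one is a multiple of a Gaussian
density, provided the resulting precision is positive. -/
lemma gauss1_mul_div {a b M P Q R S : ℝ} (hP : 0 < P) (hQ : 0 < Q) (hR : 0 < R) (hS : 0 < S)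
    (hprec : S⁻¹ = P⁻¹ + Q⁻¹ - R⁻¹) (hmean : M * S⁻¹ = a * P⁻¹ + b * Q⁻¹) (x : ℝ) :
    gauss1 x a P * gauss1 x b Q / gauss1 x 0 R =
      √(R * S / (P * Q)) * exp ((M ^ 2 / S - a ^ 2 / P - b ^ 2 / Q) / 2) * gauss1 x M S := by
  have hexp : exp (-(x - a) ^ 2 / (2 * P)) * exp (-(x - b) ^ 2 / (2 * Q)) =
      exp ((M ^ 2 / S - a ^ 2 / P - b ^ 2 / Q) / 2) * exp (-(x - M) ^ 2 / (2 * S)) *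
        exp (-(x - 0) ^ 2 / (2 * R)) := by
    simp only [← exp_add]
    congr 1
    simp only [div_eq_mul_inv, mul_inv]
    linear_combination (x ^ 2 / 2) * hprec - x * hmean
  have hsqrt : (√(2 * π * P))⁻¹ * (√(2 * π * Q))⁻¹ =
      √(R * S / (P * Q)) * (√(2 * π * S))⁻¹ * (√(2 * π * R))⁻¹ := by
    simp only [← sqrt_inv]
    rw [← sqrt_mul (by positivity), ← sqrt_mul (by positivity), ← sqrt_mul (by positivity)]
    congr 1
    field_simp
  rw [div_eq_iff (gauss1_pos x 0 hR).ne', gauss1_eq_inv_sqrt_mul_exp x a hP,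
    gauss1_eq_inv_sqrt_mul_exp x b hQ, gauss1_eq_inv_sqrt_mul_exp x 0 hR,
    gauss1_eq_inv_sqrt_mul_exp x M hS, mul_mul_mul_comm, hexp, hsqrt]
  ring

lemma log_gauss1_zero (x : ℝ) {P : ℝ} (hP : 0 < P) :
    log (gauss1 x 0 P) = log (gauss1 0 0 P) - x ^ 2 / (2 * P) := by
  have h : gauss1 x 0 P = gauss1 0 0 P * exp (-(x ^ 2 / (2 * P))) := by
    simp [gauss1_eq_inv_sqrt_mul_exp _ _ hP, neg_div]
  rw [h, log_mul (gauss1_pos 0 0 hP).ne' (exp_ne_zero _), log_exp, sub_eq_add_neg]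

lemma gauss1_narrow_le (x : ℝ) : gauss1 x 0 0.1 ≤ 4.26 * gauss1 x 0 1.81 := by
  rw [gauss1_eq_inv_sqrt_mul_exp x 0 (by norm_num), gauss1_eq_inv_sqrt_mul_exp x 0 (by norm_num),
    ← mul_assoc]
  gcongr ?_ * exp ?_
  · rw [← div_eq_mul_inv, le_div_iff₀ (by positivity), ← sqrt_inv, ← sqrt_mul (by positivity)]
    refine sqrt_le_iff.2 ⟨by norm_num, ?_⟩
    field_simp
    norm_num
  · rw [div_le_div_iff₀ (by norm_num) (by norm_num)]
    nlinarith [sq_nonneg (x - 0)]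

lemma exp_upper : exp (5 / 13 * 4.26) ≤ 5.26 := by
  have h := exp_bound' (x := 5 / 13 * 4.26 / 2) (by norm_num) (by norm_num) (n := 8) (by norm_num)
  have h2 : exp (5 / 13 * 4.26) = exp (5 / 13 * 4.26 / 2) ^ 2 := by
    rw [← exp_nat_mul]; norm_num
  norm_num [Finset.sum_range_succ, Nat.factorial] at h h2 ⊢
  rw [h2]
  refine (pow_le_pow_left₀ (exp_pos _).le h 2).trans ?_
  norm_num

lemma mul_le_log_one_add {z : ℝ} (hz : 0 ≤ z) (hz' : z ≤ 4.26) :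
    5 / 13 * z ≤ log (1 + z) := by
  rw [le_log_iff_exp_le (by positivity)]
  have h := convexOn_exp.2 (Set.mem_univ 0) (Set.mem_univ (5 / 13 * 4.26))
    (sub_nonneg.2 ((div_le_one (by norm_num)).2 hz')) (by positivity : 0 ≤ z / 4.26) (by ring)
  simp only [smul_eq_mul, mul_zero, exp_zero, mul_one, zero_add] at h
  have h2 := mul_le_mul_of_nonneg_left exp_upper (by positivity : 0 ≤ z / 4.26)
  have h3 : z / 4.26 * (5 / 13 * 4.26) = 5 / 13 * z := by ring
  rw [h3] at h
  linarith

lemma log_one_add_le {z : ℝ} (hz : 0 ≤ z) : log (1 + z) ≤ 5 / 13 * z + 0.3404 := by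
  have hlog : log (13 / 5) ≤ 0.9556 := by
    rw [log_le_iff_le_exp (by norm_num)]
    have h := sum_le_exp_of_nonneg (x := 0.9556) (by norm_num) 10
    refine le_trans ?_ h
    norm_num [Finset.sum_range_succ, Nat.factorial]
  have h := log_le_sub_one_of_pos (x := (1 + z) / (13 / 5)) (by positivity)
  rw [log_div (by positivity) (by norm_num)] at h
  linarith

/-- Tangent-line bound for the convex function `t ↦ t * log t`. -/
lemma mul_log_sub_mul_log_ge {p q : ℝ} (hp : 0 < p) (hq : 0 < q) :
    (p - q) * (1 + log q) ≤ p * log p - q * log q := by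
  have h := log_le_sub_one_of_pos (div_pos hq hp)
  rw [log_div hq.ne' hp.ne'] at h
  have h2 := mul_le_mul_of_nonneg_left h hp.le
  have h3 : p * (q / p - 1) = q - p := by field_simp
  linarith

lemma mul_log_sub_mul_log_le {p q : ℝ} (hp : 0 < p) (hq : 0 < q) :
    p * log p - q * log q ≤ (p - q) * (1 + log q) + (p - q) ^ 2 / q := by
  have h := log_le_sub_one_of_pos (div_pos hp hq)
  rw [log_div hp.ne' hq.ne'] at h
  have h2 := mul_le_mul_of_nonneg_left h hp.le
  have h3 : p * (p / q - 1) = (p - q) + (p - q) ^ 2 / q := by field_simp; ring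
  linarith

section Pointwise

variable {m n s : ℝ}

lemma log_add_div_two (hn : 0 < n) (hs : 0 < s) :
    log ((n + s) / 2) = log (n / 2) + log (1 + s / n) := by
  rw [← log_mul (by positivity) (by positivity)]
  congr 1
  field_simp

lemma entropy_diff_ge (hm : 0 < m) (hn : 0 < n) (hs : 0 < s) (hsn : s ≤ 4.26 * n) :
    (m - n) / 2 * (1 + log (n / 2)) - 2 * (m + n) ≤
      (m + s) / 2 * log ((m + s) / 2) - (n + s) / 2 * log ((n + s) / 2) := by
  refine le_trans ?_ (mul_log_sub_mul_log_ge (by positivity) (by positivity))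
  have hz : s / n ≤ 4.26 := (div_le_iff₀ hn).2 hsn
  have hz0 : 0 ≤ s / n := by positivity
  rw [log_add_div_two hn hs]
  have h1 := log_one_add_le hz0
  have h0 : 0 ≤ log (1 + s / n) := log_nonneg (by linarith)
  nlinarith

lemma entropy_diff_le (hm : 0 < m) (hn : 0 < n) (hs : 0 < s) (hsn : s ≤ 4.26 * n) :
    (m + s) / 2 * log ((m + s) / 2) - (n + s) / 2 * log ((n + s) / 2) ≤
      (m - n) / 2 * (1 + log (n / 2)) + (m - n) / 2 * (5 / 13 * (s / n) + 0.1702)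
        + 0.04255 * (10 * ((m - n) ^ 2 / n) + n / 10) + (m - n) ^ 2 / n / 2 := by
  refine (mul_log_sub_mul_log_le (by positivity) (by positivity)).trans ?_
  have hz : s / n ≤ 4.26 := (div_le_iff₀ hn).2 hsn
  have hz0 : 0 ≤ s / n := by positivity
  rw [log_add_div_two hn hs]
  have hchi : ((m + s) / 2 - (n + s) / 2) ^ 2 / ((n + s) / 2) ≤ (m - n) ^ 2 / n / 2 := by
    have : (m - n) ^ 2 / n / 2 = ((m + s) / 2 - (n + s) / 2) ^ 2 / (n / 2) := by
      field_simp; ring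
    rw [this]
    gcongr
    linarith
  have habs : 2 * |m - n| ≤ 10 * ((m - n) ^ 2 / n) + n / 10 := by
    have : 10 * ((m - n) ^ 2 / n) + n / 10 - 2 * |m - n| = (10 * |m - n| - n) ^ 2 / (10 * n) := by
      rw [← sq_abs (m - n)]
      field_simp
      ring
    have : 0 ≤ (10 * |m - n| - n) ^ 2 / (10 * n) := by positivity
    linarith
  have h1 := log_one_add_le hz0
  have h0 := mul_le_log_one_add hz0 hz
  have hlog : (m - n) * log (1 + s / n) ≤
      (m - n) * (5 / 13 * (s / n) + 0.1702) + 0.1702 * |m - n| := by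
    rcases abs_cases (m - n) with ⟨h, h'⟩ | ⟨h, h'⟩ <;> rw [h] <;> nlinarith
  linarith

end Pointwise

/-- The equal-weight mixture of the two components that are merged. -/
noncomputable def mergedPair (x : ℝ) : ℝ := (gauss1 x (-0.9) 1 + gauss1 x 0.9 1) / 2

lemma mergedPair_pos (x : ℝ) : 0 < mergedPair x :=
  half_pos (add_pos (gauss1_pos x _ one_pos) (gauss1_pos x _ one_pos))

lemma integrable_mergedPair : Integrable mergedPair :=
  ((integrable_gauss1 _ one_pos).add (integrable_gauss1 _ one_pos)).div_const 2

lemma integral_mergedPair : ∫ x, mergedPair x = 1 := by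
  simp only [mergedPair]
  rw [integral_div, integral_add (integrable_gauss1 _ one_pos) (integrable_gauss1 _ one_pos),
    integral_gauss1 _ one_pos, integral_gauss1 _ one_pos]
  norm_num

lemma sq_mul_mergedPair_eq : (fun x => x ^ 2 * mergedPair x) =
    fun x => (x ^ 2 * gauss1 x (-0.9) 1 + x ^ 2 * gauss1 x 0.9 1) / 2 := by
  funext x; rw [mergedPair]; ring

lemma integrable_sq_mul_mergedPair : Integrable fun x => x ^ 2 * mergedPair x := by
  rw [sq_mul_mergedPair_eq]
  exact ((integrable_sq_mul_gauss1 _ one_pos).add (integrable_sq_mul_gauss1 _ one_pos)).div_const 2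

lemma integral_sq_mul_mergedPair : ∫ x, x ^ 2 * mergedPair x = 1.81 := by
  rw [sq_mul_mergedPair_eq, integral_div,
    integral_add (integrable_sq_mul_gauss1 _ one_pos) (integrable_sq_mul_gauss1 _ one_pos),
    integral_sq_mul_gauss1 _ one_pos, integral_sq_mul_gauss1 _ one_pos]
  norm_num

lemma mergedPair_sq_div_eq : (fun x => mergedPair x ^ 2 / gauss1 x 0 1.81) = fun x =>
    √(1.81 ^ 2 / 2.62) / 4 * (exp (0.81 / 2.62) * (gauss1 x (-3.258 / 2.62) (1.81 / 2.62) +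
      gauss1 x (3.258 / 2.62) (1.81 / 2.62)) + 2 * exp (-0.81) * gauss1 x 0 (1.81 / 2.62)) := by
  funext x
  have hsplit : mergedPair x ^ 2 / gauss1 x 0 1.81 =
      (gauss1 x (-0.9) 1 * gauss1 x (-0.9) 1 / gauss1 x 0 1.81
        + gauss1 x 0.9 1 * gauss1 x 0.9 1 / gauss1 x 0 1.81
        + 2 * (gauss1 x (-0.9) 1 * gauss1 x 0.9 1 / gauss1 x 0 1.81)) / 4 := by
    rw [mergedPair]; ring
  rw [hsplit,
    gauss1_mul_div (a := -0.9) (b := -0.9) (M := -3.258 / 2.62) (P := 1) (Q := 1) (R := 1.81)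
      (S := 1.81 / 2.62) (by norm_num) (by norm_num) (by norm_num) (by norm_num) (by norm_num)
      (by norm_num),
    gauss1_mul_div (a := 0.9) (b := 0.9) (M := 3.258 / 2.62) (P := 1) (Q := 1) (R := 1.81)
      (S := 1.81 / 2.62) (by norm_num) (by norm_num) (by norm_num) (by norm_num) (by norm_num)
      (by norm_num),
    gauss1_mul_div (a := -0.9) (b := 0.9) (M := 0) (P := 1) (Q := 1) (R := 1.81)
      (S := 1.81 / 2.62) (by norm_num) (by norm_num) (by norm_num) (by norm_num) (by norm_num)
      (by norm_num)]
  norm_num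
  ring

lemma integrable_mergedPair_sq_div :
    Integrable fun x => mergedPair x ^ 2 / gauss1 x 0 1.81 := by
  have hS : (0 : ℝ) < 1.81 / 2.62 := by norm_num
  rw [mergedPair_sq_div_eq]
  exact ((((integrable_gauss1 _ hS).add (integrable_gauss1 _ hS)).const_mul _).add
    ((integrable_gauss1 _ hS).const_mul _)).const_mul _

lemma integral_mergedPair_sq_div : ∫ x, mergedPair x ^ 2 / gauss1 x 0 1.81 =
    √(1.81 ^ 2 / 2.62) / 2 * (exp (0.81 / 2.62) + exp (-0.81)) := by
  have hS : (0 : ℝ) < 1.81 / 2.62 := by norm_num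
  rw [mergedPair_sq_div_eq, integral_const_mul, integral_add
    ((Integrable.fun_add (integrable_gauss1 _ hS) (integrable_gauss1 _ hS)).const_mul _)
    ((integrable_gauss1 _ hS).const_mul _), integral_const_mul, integral_const_mul,
    integral_add (integrable_gauss1 _ hS) (integrable_gauss1 _ hS)]
  simp only [integral_gauss1 _ hS]
  ring

lemma integral_mergedPair_sq_div_le :
    ∫ x, mergedPair x ^ 2 / gauss1 x 0 1.81 ≤ 1.0106 := by
  have hsqrt : √(1.81 ^ 2 / 2.62) ≤ 1.1183 := sqrt_le_iff.2 ⟨by norm_num, by norm_num⟩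
  have h1 : exp (0.81 / 2.62) ≤ 1.3623 := by
    have h := exp_bound' (x := 0.81 / 2.62) (by norm_num) (by norm_num) (n := 8) (by norm_num)
    refine h.trans ?_
    norm_num [Finset.sum_range_succ, Nat.factorial]
  have h2 : exp (-0.81) ≤ 0.4449 := by
    have h := sum_le_exp_of_nonneg (x := 0.81) (by norm_num) 10
    rw [exp_neg, inv_le_comm₀ (exp_pos _) (by norm_num)]
    refine le_trans ?_ h
    norm_num [Finset.sum_range_succ, Nat.factorial]
  rw [integral_mergedPair_sq_div]
  calc _ ≤ (1.1183 : ℝ) / 2 * (1.3623 + 0.4449) := by gcongr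
    _ ≤ _ := by norm_num

lemma mergedPair_mul_div_eq : (fun x => mergedPair x * gauss1 x 0 0.1 / gauss1 x 0 1.81) = fun x =>
    √(18.1 * 1.81 / 18.91) * exp (-6.9255 / 18.91) / 2 *
      (gauss1 x (-1.629 / 18.91) (1.81 / 18.91) + gauss1 x (1.629 / 18.91) (1.81 / 18.91)) := by
  funext x
  have hsplit : mergedPair x * gauss1 x 0 0.1 / gauss1 x 0 1.81 =
      (gauss1 x (-0.9) 1 * gauss1 x 0 0.1 / gauss1 x 0 1.81
        + gauss1 x 0.9 1 * gauss1 x 0 0.1 / gauss1 x 0 1.81) / 2 := by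
    rw [mergedPair]; ring
  rw [hsplit,
    gauss1_mul_div (a := -0.9) (b := 0) (M := -1.629 / 18.91) (P := 1) (Q := 0.1) (R := 1.81)
      (S := 1.81 / 18.91) (by norm_num) (by norm_num) (by norm_num) (by norm_num) (by norm_num)
      (by norm_num),
    gauss1_mul_div (a := 0.9) (b := 0) (M := 1.629 / 18.91) (P := 1) (Q := 0.1) (R := 1.81)
      (S := 1.81 / 18.91) (by norm_num) (by norm_num) (by norm_num) (by norm_num) (by norm_num)
      (by norm_num)]
  norm_num
  ring

lemma integrable_mergedPair_mul_div :
    Integrable fun x => mergedPair x * gauss1 x 0 0.1 / gauss1 x 0 1.81 := by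
  have hS : (0 : ℝ) < 1.81 / 18.91 := by norm_num
  rw [mergedPair_mul_div_eq]
  exact ((integrable_gauss1 _ hS).add (integrable_gauss1 _ hS)).const_mul _

lemma integral_mergedPair_mul_div_le :
    ∫ x, mergedPair x * gauss1 x 0 0.1 / gauss1 x 0 1.81 ≤ 0.913 := by
  have hS : (0 : ℝ) < 1.81 / 18.91 := by norm_num
  have hsqrt : √(18.1 * 1.81 / 18.91) ≤ 1.3164 := sqrt_le_iff.2 ⟨by norm_num, by norm_num⟩
  have hexp : exp (-6.9255 / 18.91) ≤ 0.6934 := by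
    have h := sum_le_exp_of_nonneg (x := 6.9255 / 18.91) (by norm_num) 10
    rw [neg_div, exp_neg, inv_le_comm₀ (exp_pos _) (by norm_num)]
    refine le_trans ?_ h
    norm_num [Finset.sum_range_succ, Nat.factorial]
  rw [mergedPair_mul_div_eq, integral_const_mul,
    integral_add (integrable_gauss1 _ hS) (integrable_gauss1 _ hS)]
  simp only [integral_gauss1 _ hS]
  calc _ ≤ (1.3164 : ℝ) * 0.6934 / 2 * (1 + 1) := by gcongr
    _ ≤ _ := by norm_num

/-- Counter-example: the differential entropy change under the Kullback–Leibler
merge of the first two components is strictly negative. -/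
theorem entropy_counterexample :
    (∫ x : ℝ,
      ((0.25 * gauss1 x (-0.9) 1 + 0.25 * gauss1 x 0.9 1 + 0.5 * gauss1 x 0 0.1) *
          Real.log (0.25 * gauss1 x (-0.9) 1 + 0.25 * gauss1 x 0.9 1 + 0.5 * gauss1 x 0 0.1)
        - (0.5 * gauss1 x 0 1.81 + 0.5 * gauss1 x 0 0.1) *
          Real.log (0.5 * gauss1 x 0 1.81 + 0.5 * gauss1 x 0 0.1))) < 0 := by
  have hv : (0 : ℝ) < 1.81 := by norm_num
  have hw : (0 : ℝ) < 0.1 := by norm_num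
  have hp : ∀ x, 0.25 * gauss1 x (-0.9) 1 + 0.25 * gauss1 x 0.9 1 + 0.5 * gauss1 x 0 0.1 =
      (mergedPair x + gauss1 x 0 0.1) / 2 := fun x => by rw [mergedPair]; ring
  have hq : ∀ x, 0.5 * gauss1 x 0 1.81 + 0.5 * gauss1 x 0 0.1 =
      (gauss1 x 0 1.81 + gauss1 x 0 0.1) / 2 := fun x => by ring
  simp only [hp, hq]
  set F : ℝ → ℝ := fun x =>
    (mergedPair x + gauss1 x 0 0.1) / 2 * log ((mergedPair x + gauss1 x 0 0.1) / 2) -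
      (gauss1 x 0 1.81 + gauss1 x 0 0.1) / 2 * log ((gauss1 x 0 1.81 + gauss1 x 0 0.1) / 2) with hF
  obtain ⟨C, hC⟩ : ∃ C, ∀ x, 1 + log (gauss1 x 0 1.81 / 2) = C - x ^ 2 / 3.62 :=
    ⟨1 + log (gauss1 0 0 1.81) - log 2, fun x => by
      rw [log_div (gauss1_pos x 0 hv).ne' two_ne_zero, log_gauss1_zero x hv]; ring⟩
  have im := integrable_mergedPair
  have iN := integrable_gauss1 0 hv
  have is := integrable_gauss1 0 hw
  have im2 := integrable_sq_mul_mergedPair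
  have iN2 := integrable_sq_mul_gauss1 0 hv
  have iW := integrable_mergedPair_sq_div
  have iV := integrable_mergedPair_mul_div
  let comb (a b c d e f g : ℝ) (x : ℝ) : ℝ := a * mergedPair x + b * gauss1 x 0 1.81
    + c * gauss1 x 0 0.1 + d * (x ^ 2 * mergedPair x) + e * (x ^ 2 * gauss1 x 0 1.81)
    + f * (mergedPair x ^ 2 / gauss1 x 0 1.81)
    + g * (mergedPair x * gauss1 x 0 0.1 / gauss1 x 0 1.81)
  have icomb (a b c d e f g : ℝ) : Integrable (comb a b c d e f g) :=
    ((((((im.const_mul a).add (iN.const_mul b)).add (is.const_mul c)).add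
      (im2.const_mul d)).add (iN2.const_mul e)).add (iW.const_mul f)).add (iV.const_mul g)
  have hcomb (a b c d e f g : ℝ) : ∫ x, comb a b c d e f g x = a + b + c + d * 1.81 + e * 1.81
      + f * (∫ x, mergedPair x ^ 2 / gauss1 x 0 1.81)
      + g * (∫ x, mergedPair x * gauss1 x 0 0.1 / gauss1 x 0 1.81) := by
    simp only [comb]
    rw [integral_add (by fun_prop) (by fun_prop), integral_add (by fun_prop) (by fun_prop),
      integral_add (by fun_prop) (by fun_prop), integral_add (by fun_prop) (by fun_prop),
      integral_add (by fun_prop) (by fun_prop), integral_add (by fun_prop) (by fun_prop)]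
    simp only [integral_const_mul, integral_mergedPair, integral_gauss1 0 hv,
      integral_gauss1 0 hw, integral_sq_mul_mergedPair, integral_sq_mul_gauss1 0 hv]
    ring
  have hlower : ∀ x, comb (C / 2 - 2) (-C / 2 - 2) 0 (-1 / 7.24) (1 / 7.24) 0 0 x ≤ F x := by
    intro x
    refine le_of_eq_of_le ?_ (entropy_diff_ge (mergedPair_pos x) (gauss1_pos x 0 hv)
      (gauss1_pos x 0 hw) (gauss1_narrow_le x))
    rw [hC]
    simp only [comb]
    ring
  have hupper : ∀ x, F x ≤ comb (C / 2 + 0.0851 - 1.851) (-C / 2 - 0.0851 + 0.9255 + 0.004255)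
      (-5 / 26) (-1 / 7.24) (1 / 7.24) 0.9255 (5 / 26) x := by
    intro x
    refine (entropy_diff_le (mergedPair_pos x) (gauss1_pos x 0 hv)
      (gauss1_pos x 0 hw) (gauss1_narrow_le x)).trans_eq ?_
    rw [hC]
    simp only [comb]
    have := (gauss1_pos x 0 hv).ne'
    field_simp
    ring
  have hmeas : AEStronglyMeasurable F := by
    have hm : Measurable mergedPair := by unfold mergedPair gauss1; fun_prop
    have hg (P : ℝ) : Measurable fun x => gauss1 x 0 P := by unfold gauss1; fun_prop
    have := hg 1.81
    have := hg 0.1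
    exact Measurable.aestronglyMeasurable (by fun_prop)
  have iF : Integrable F := integrable_of_le_of_le hmeas (ae_of_all _ hlower)
    (ae_of_all _ hupper) (icomb _ _ _ _ _ _ _) (icomb _ _ _ _ _ _ _)
  refine (integral_mono iF (icomb _ _ _ _ _ _ _) hupper).trans_lt ?_
  rw [hcomb]
  linarith [integral_mergedPair_sq_div_le, integral_mergedPair_mul_div_le]
end
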